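/- For a connected weighted graph and any node i, the node resistance curvature equals the expected combinatorial curvature of i over a random spanning tree: p_i = Σ_{T∈𝒯} Pr[𝐓 = T]·(1 − d_i^{(T)}/2), where d_i^{(T)} is the degree of node i in the spanning tree T. -/

import Mathlib

open Matrix

variable {V : Type*}

/- The weighted Laplacian matrix of a weighted graph `(V, G, c)`:
`Q i i = ∑_{k ∼ i} c i k`, `Q i j = -c i j` for links `i ∼ j`, and `0` otherwise. -/
open Classical in
noncomputable def lapMatrix [Fintype V] (G : SimpleGraph V) (c : V → V → ℝ) :
    Matrix V V ℝ :=
  Matrix.of fun i j =>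
    if i = j then ∑ k, if G.Adj i k then c i k else 0
    else if G.Adj i j then -c i j else 0

/- The four Penrose equations characterizing the Moore–Penrose pseudoinverse. -/
def IsMoorePenroseInv [Fintype V] (Q Qd : Matrix V V ℝ) : Prop :=
  Q * Qd * Q = Q ∧ Qd * Q * Qd = Qd ∧ (Q * Qd)ᵀ = Q * Qd ∧ (Qd * Q)ᵀ = Qd * Q

/- The effective resistance `ω i j = (e_i - e_j)ᵀ Q† (e_i - e_j)`, computed from a
pseudoinverse `Qd` of the Laplacian. -/
open Classical in
noncomputable def effRes [Fintype V] (Qd : Matrix V V ℝ) (i j : V) : ℝ :=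
  (Pi.single i 1 - Pi.single j 1) ⬝ᵥ Qd *ᵥ (Pi.single i 1 - Pi.single j 1)

/- The node resistance curvature `p i = 1 - (1/2) ∑_{j ∼ i} c i j * ω i j`. -/
open Classical in
noncomputable def nodeCurv [Fintype V] (G : SimpleGraph V) (c : V → V → ℝ)
    (Qd : Matrix V V ℝ) (i : V) : ℝ :=
  1 - 1 / 2 * ∑ j, if G.Adj i j then c i j * effRes Qd i j else 0

/- The weight `c(T)` of a subgraph: the product of the weights of its links. -/
noncomputable def treeWeight (c : V → V → ℝ) (hc : ∀ i j, c i j = c j i)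
    (T : SimpleGraph V) : ℝ :=
  ∏ᶠ e ∈ T.edgeSet, Sym2.lift ⟨c, fun a b => hc a b⟩ e

namespace SimpleGraph

/-- `F` is a spanning forest of `G` with exactly two components, one containing `a` and the other
containing `b`. -/
structure IsSplitForest (G : SimpleGraph V) (a b : V) (F : SimpleGraph V) : Prop where
  le : F ≤ G
  isAcyclic : F.IsAcyclic
  not_reachable : ¬ F.Reachable a b
  cover : ∀ v, F.Reachable a v ∨ F.Reachable b v

theorem reachable_left_or_right_of_sup_edge {F : SimpleGraph V} {a b v : V}
    (h : (F ⊔ edge a b).Reachable a v) : F.Reachable a v ∨ F.Reachable b v := by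
  have key : ∀ u w : V, (F ⊔ edge a b).Walk u w →
      F.Reachable a u ∨ F.Reachable b u → F.Reachable a w ∨ F.Reachable b w := by
    intro u w p
    induction p with
    | nil => exact id
    | @cons u x w hux p ih =>
      intro hu
      apply ih
      rw [sup_adj, edge_adj] at hux
      rcases hux with hux | ⟨⟨rfl, rfl⟩ | ⟨rfl, rfl⟩, -⟩
      · exact hu.imp (·.trans hux.reachable) (·.trans hux.reachable)
      · exact Or.inr .rfl
      · exact Or.inl .rfl
  obtain ⟨p⟩ := h
  exact key a v p (Or.inl .rfl)

theorem deleteEdges_sup_edge {T : SimpleGraph V} {a b : V} (h : T.Adj a b) :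
    T.deleteEdges {s(a, b)} ⊔ edge a b = T := by
  ext x y
  rw [sup_adj, deleteEdges_adj, adj_edge, Set.mem_singleton_iff]
  constructor
  · rintro (h' | ⟨h', -⟩)
    · exact h'.1
    · rwa [← mem_edgeSet, ← h', mem_edgeSet]
  · intro h'
    by_cases hxy : s(a, b) = s(x, y)
    · exact Or.inr ⟨hxy, h'.ne⟩
    · exact Or.inl ⟨h', fun h ↦ hxy h.symm⟩

theorem sup_edge_deleteEdges {F : SimpleGraph V} {a b : V} (h : ¬ F.Adj a b) :
    (F ⊔ edge a b).deleteEdges {s(a, b)} = F := by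
  rw [deleteEdges_sup, deleteEdges_edge (Set.mem_singleton _), sup_bot_eq]
  ext x y
  rw [deleteEdges_adj, Set.mem_singleton_iff]
  refine ⟨And.left, fun h' ↦ ⟨h', fun hxy ↦ h ?_⟩⟩
  rwa [← mem_edgeSet, ← hxy, mem_edgeSet]

theorem IsTree.isSplitForest_deleteEdges {G T : SimpleGraph V} {a b : V} (hT : T.IsTree)
    (hle : T ≤ G) (h : T.Adj a b) : G.IsSplitForest a b (T.deleteEdges {s(a, b)}) where
  le := (deleteEdges_le _).trans hle
  isAcyclic := hT.isAcyclic.anti (deleteEdges_le _)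
  not_reachable := isBridge_iff.mp (isAcyclic_iff_forall_adj_isBridge.mp hT.isAcyclic h)
  cover v := by
    apply reachable_left_or_right_of_sup_edge
    rw [deleteEdges_sup_edge h]
    exact hT.connected.preconnected a v

theorem IsSplitForest.isTree_sup_edge {G F : SimpleGraph V} {a b : V}
    (hF : G.IsSplitForest a b F) : (F ⊔ edge a b).IsTree := by
  have hne : a ≠ b := fun h ↦ hF.not_reachable (h ▸ .rfl)
  have hab : (F ⊔ edge a b).Reachable a b :=
    Adj.reachable (Or.inr ((edge_adj ..).mpr ⟨Or.inl ⟨rfl, rfl⟩, hne⟩))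
  have ha (v : V) : (F ⊔ edge a b).Reachable a v :=
    (hF.cover v).elim (·.mono le_sup_left) fun h ↦ hab.trans (h.mono le_sup_left)
  have : Nonempty V := ⟨a⟩
  exact ⟨⟨fun u v ↦ (ha u).symm.trans (ha v)⟩,
    hF.isAcyclic.sup_edge_of_not_reachable hF.not_reachable⟩

theorem IsSplitForest.not_adj {G F : SimpleGraph V} {a b : V} (hF : G.IsSplitForest a b F) :
    ¬ F.Adj a b := fun h ↦ hF.not_reachable h.reachable

theorem IsSplitForest.sup_edge_le {G F : SimpleGraph V} {a b : V} (hF : G.IsSplitForest a b F)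
    (h : G.Adj a b) : F ⊔ edge a b ≤ G :=
  sup_le hF.le ((edge_le_iff _).mpr (Or.inr h))

theorem IsTree.adj_and_reachable_iff_eq_snd {T : SimpleGraph V} (hT : T.IsTree) {x v : V}
    (hne : v ≠ x) {p : T.Walk x v} (hp : p.IsPath) (y : V) :
    T.Adj x y ∧ (T.deleteEdges {s(x, y)}).Reachable v y ↔ y = p.snd := by
  classical
  constructor
  · rintro ⟨hxy, hr⟩
    obtain ⟨q, hq⟩ := hr.symm.exists_isPath
    have hle : T.deleteEdges {s(x, y)} ≤ T := deleteEdges_le _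
    have hpath : (Walk.cons hxy (q.mapLe hle)).IsPath := by
      rw [hT.isAcyclic.isPath_iff_isTrail, Walk.isTrail_cons]
      refine ⟨(hq.mapLe hle).isTrail, fun hmem ↦ ?_⟩
      rw [Walk.edges_mapLe_eq_edges] at hmem
      have := q.edges_subset_edgeSet hmem
      simp at this
    have := (hT.existsUnique_path x v).unique hpath hp
    rw [← this, Walk.snd_cons]
  · rintro rfl
    cases p with
    | nil => exact absurd rfl hne
    | @cons _ y _ hxy p =>
      rw [Walk.snd_cons]
      rw [Walk.cons_isPath_iff] at hp
      refine ⟨hxy, Reachable.symm ⟨p.toDeleteEdge s(x, y) fun h ↦ hp.2 ?_⟩⟩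
      exact p.fst_mem_support_of_mem_edges h

open Classical in
theorem IsTree.sum_adj_reachable [Fintype V] {T : SimpleGraph V} (hT : T.IsTree) (x v : V) :
    (∑ y, if T.Adj x y then
      (if (T.deleteEdges {s(x, y)}).Reachable v y then (1 : ℝ) else 0) else 0) =
      if v = x then 0 else 1 := by
  split_ifs with hvx
  · subst hvx
    refine Finset.sum_eq_zero fun y _ ↦ ?_
    split_ifs with h1 h2
    · exact absurd h2 (isAcyclic_iff_forall_adj_isBridge.mp hT.isAcyclic h1)
    all_goals rfl
  · obtain ⟨p, hp, -⟩ := hT.existsUnique_path x v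
    simp_rw [← ite_and, hT.adj_and_reachable_iff_eq_snd hvx hp]
    simp

open Classical in
/-- For fixed `F`, the two-component forests separating `a, b` and those separating `x, y` give the
same signed contribution to the current through `x, y`. -/
theorem ite_isSplitForest_swap (G F : SimpleGraph V) (a b x y : V) :
    (if G.IsSplitForest a b F then
      ((if F.Reachable a x then (1 : ℝ) else 0) - if F.Reachable a y then 1 else 0) else 0) =
    if G.IsSplitForest x y F then
      ((if F.Reachable b y then (1 : ℝ) else 0) - if F.Reachable a y then 1 else 0) else 0 := by
  have hs (u v : V) : F.Reachable u v → F.Reachable v u := Reachable.symm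
  have ht (u v w : V) : F.Reachable u v → F.Reachable v w → F.Reachable u w := Reachable.trans
  by_cases h1 : G.IsSplitForest a b F <;> by_cases h2 : G.IsSplitForest x y F
  · have := h1.not_reachable
    have := h2.not_reachable
    have := h1.cover x
    have := h1.cover y
    rw [if_pos h1, if_pos h2]
    by_cases F.Reachable a x <;> by_cases F.Reachable a y <;> by_cases F.Reachable b y <;>
      simp_all <;> grind
  · have hxy : F.Reachable x y := by
      by_contra hxy
      refine h2 ⟨h1.le, h1.isAcyclic, hxy, fun v ↦ ?_⟩
      have := h1.cover v
      have := h1.cover x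
      have := h1.cover y
      grind
    have : F.Reachable a x ↔ F.Reachable a y := ⟨(·.trans hxy), (·.trans hxy.symm)⟩
    simp [h2, this]
  · have hab : F.Reachable a b := by
      by_contra hab
      refine h1 ⟨h2.le, h2.isAcyclic, hab, fun v ↦ ?_⟩
      have := h2.cover v
      have := h2.cover a
      have := h2.cover b
      grind
    have : F.Reachable a y ↔ F.Reachable b y := ⟨hab.symm.trans, hab.trans⟩
    simp [h1, this]
  · simp [h1, h2]

end SimpleGraph

open SimpleGraph hiding lapMatrix

theorem treeWeight_sup_edge [Finite V] {c : V → V → ℝ} (hc : ∀ i j, c i j = c j i)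
    {F : SimpleGraph V} {a b : V} (hne : a ≠ b) (h : ¬ F.Adj a b) :
    treeWeight c hc (F ⊔ edge a b) = c a b * treeWeight c hc F := by
  unfold treeWeight
  rw [edgeSet_sup, edgeSet_edge_of_ne hne, Set.union_singleton,
    finprod_mem_insert _ (by simpa using h) (Set.toFinite _), Sym2.lift_mk]

theorem treeWeight_pos {c : V → V → ℝ} (hc : ∀ i j, c i j = c j i) {G T : SimpleGraph V}
    (hpos : ∀ i j, G.Adj i j → 0 < c i j) (hle : T ≤ G) : 0 < treeWeight c hc T := by
  unfold treeWeight
  refine finprod_mem_induction (0 < ·) one_pos (fun _ _ ↦ mul_pos) ?_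
  rintro ⟨a, b⟩ h
  exact hpos a b (hle h)

open Classical in
theorem mul_sum_isSplitForest [Fintype V] (G : SimpleGraph V) {c : V → V → ℝ}
    (hc : ∀ i j, c i j = c j i) {a b : V} (hab : G.Adj a b) (φ : SimpleGraph V → ℝ) :
    c a b * ∑ F with G.IsSplitForest a b F, treeWeight c hc F * φ F =
      ∑ T with T ≤ G ∧ T.IsTree,
        if T.Adj a b then treeWeight c hc T * φ (T.deleteEdges {s(a, b)}) else 0 := by
  rw [← Finset.sum_filter, Finset.mul_sum]
  refine Finset.sum_bij' (fun F _ ↦ F ⊔ edge a b) (fun T _ ↦ T.deleteEdges {s(a, b)}) ?_ ?_ ?_ ?_ ?_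
  · intro F hF
    simp only [Finset.mem_filter, Finset.mem_univ, true_and] at hF ⊢
    exact ⟨⟨hF.sup_edge_le hab, hF.isTree_sup_edge⟩,
      Or.inr ((edge_adj ..).mpr ⟨Or.inl ⟨rfl, rfl⟩, hab.ne⟩)⟩
  · intro T hT
    simp only [Finset.mem_filter, Finset.mem_univ, true_and] at hT ⊢
    exact hT.1.2.isSplitForest_deleteEdges hT.1.1 hT.2
  · intro F hF
    simp only [Finset.mem_filter, Finset.mem_univ, true_and] at hF
    exact sup_edge_deleteEdges hF.not_adj
  · intro T hT
    simp only [Finset.mem_filter, Finset.mem_univ, true_and] at hT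
    exact deleteEdges_sup_edge hT.2
  · intro F hF
    simp only [Finset.mem_filter, Finset.mem_univ, true_and] at hF
    rw [sup_edge_deleteEdges hF.not_adj, treeWeight_sup_edge hc hab.ne hF.not_adj, mul_assoc]

open Classical in
/-- The (unnormalized) electric potential at `x` when a unit current flows from `a` to `b`, as a
weighted count of two-component spanning forests. -/
noncomputable def forestPotential [Fintype V] (G : SimpleGraph V) (c : V → V → ℝ)
    (hc : ∀ i j, c i j = c j i) (a b x : V) : ℝ :=
  ∑ F with G.IsSplitForest a b F, treeWeight c hc F * if F.Reachable a x then 1 else 0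

open Classical in
theorem mul_forestPotential_sub [Fintype V] (G : SimpleGraph V) {c : V → V → ℝ}
    (hc : ∀ i j, c i j = c j i) (a b : V) {x y : V} (hxy : G.Adj x y) :
    c x y * (forestPotential G c hc a b x - forestPotential G c hc a b y) =
      ∑ T with T ≤ G ∧ T.IsTree, treeWeight c hc T *
        ((if T.Adj x y then
            (if (T.deleteEdges {s(x, y)}).Reachable b y then (1 : ℝ) else 0) else 0) -
          if T.Adj x y then
            (if (T.deleteEdges {s(x, y)}).Reachable a y then 1 else 0) else 0) := by
  have hswap : forestPotential G c hc a b x - forestPotential G c hc a b y =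
      ∑ F with G.IsSplitForest x y F, treeWeight c hc F *
        ((if F.Reachable b y then (1 : ℝ) else 0) - if F.Reachable a y then 1 else 0) := by
    rw [forestPotential, forestPotential, ← Finset.sum_sub_distrib, Finset.sum_filter,
      Finset.sum_filter]
    refine Finset.sum_congr rfl fun F _ ↦ ?_
    rw [← mul_sub, ← mul_ite_zero, ← mul_ite_zero]
    congr 1
    convert ite_isSplitForest_swap G F a b x y
  rw [hswap, mul_sum_isSplitForest G hc hxy]
  refine Finset.sum_congr rfl fun T _ ↦ ?_
  split_ifs <;> simp

open Classical in
theorem lapMatrix_mulVec [Fintype V] (G : SimpleGraph V) (c : V → V → ℝ) (f : V → ℝ) (x : V) :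
    (lapMatrix G c *ᵥ f) x = ∑ y, if G.Adj x y then c x y * (f x - f y) else 0 := by
  have hentry (y : V) : lapMatrix G c x y * f y =
      (if x = y then (∑ k, if G.Adj x k then c x k else 0) * f x else 0) -
        if G.Adj x y then c x y * f y else 0 := by
    rw [lapMatrix, Matrix.of_apply]
    by_cases h : x = y
    · subst h; simp
    · by_cases h' : G.Adj x y <;> simp [h, h']
  simp_rw [mulVec, dotProduct, hentry, Finset.sum_sub_distrib, Finset.sum_ite_eq,
    Finset.mem_univ, if_true, Finset.sum_mul, ← Finset.sum_sub_distrib]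
  refine Finset.sum_congr rfl fun y _ ↦ ?_
  split_ifs <;> ring

open Classical in
theorem lapMatrix_mulVec_forestPotential [Fintype V] (G : SimpleGraph V) {c : V → V → ℝ}
    (hc : ∀ i j, c i j = c j i) (a b : V) :
    lapMatrix G c *ᵥ forestPotential G c hc a b =
      (∑ T with T ≤ G ∧ T.IsTree, treeWeight c hc T) • (Pi.single a 1 - Pi.single b 1) := by
  ext x
  have hsum (y : V) :
      (if G.Adj x y then
        c x y * (forestPotential G c hc a b x - forestPotential G c hc a b y) else 0) =
      ∑ T with T ≤ G ∧ T.IsTree, treeWeight c hc T *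
        ((if T.Adj x y then
            (if (T.deleteEdges {s(x, y)}).Reachable b y then (1 : ℝ) else 0) else 0) -
          if T.Adj x y then
            (if (T.deleteEdges {s(x, y)}).Reachable a y then 1 else 0) else 0) := by
    split_ifs with hxy
    · exact mul_forestPotential_sub G hc a b hxy
    · refine (Finset.sum_eq_zero fun T hT ↦ ?_).symm
      have hT' : ¬ T.Adj x y := fun h ↦ hxy ((Finset.mem_filter.mp hT).2.1 h)
      simp [hT']
  rw [lapMatrix_mulVec, Finset.sum_congr rfl fun y _ ↦ hsum y, Finset.sum_comm, Pi.smul_apply,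
    smul_eq_mul, Finset.sum_mul]
  refine Finset.sum_congr rfl fun T hT ↦ ?_
  have hT := (Finset.mem_filter.mp hT).2.2
  rw [← Finset.mul_sum, Finset.sum_sub_distrib, hT.sum_adj_reachable, hT.sum_adj_reachable,
    Pi.sub_apply, Pi.single_apply, Pi.single_apply]
  congr 1
  by_cases h1 : a = x <;> by_cases h2 : b = x <;> simp [h1, h2, eq_comm]

theorem lapMatrix_transpose [Fintype V] (G : SimpleGraph V) {c : V → V → ℝ}
    (hc : ∀ i j, c i j = c j i) : (lapMatrix G c)ᵀ = lapMatrix G c := by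
  classical
  ext x y
  rw [transpose_apply, lapMatrix, Matrix.of_apply, Matrix.of_apply]
  by_cases h : x = y
  · subst h; simp
  · simp [h, Ne.symm h, G.adj_comm y x, hc y x]

theorem dotProduct_mulVec_of_isMoorePenroseInv [Fintype V] {Q Qd : Matrix V V ℝ} (hQ : Qᵀ = Q)
    (hQd : IsMoorePenroseInv Q Qd) (f : V → ℝ) : (Q *ᵥ f) ⬝ᵥ Qd *ᵥ (Q *ᵥ f) = f ⬝ᵥ Q *ᵥ f := by
  nth_rewrite 1 [← hQ]
  rw [mulVec_transpose, ← dotProduct_mulVec, mulVec_mulVec, mulVec_mulVec, hQd.1]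

open Classical in
theorem forestPotential_left [Fintype V] (G : SimpleGraph V) (c : V → V → ℝ)
    (hc : ∀ i j, c i j = c j i) (a b : V) :
    forestPotential G c hc a b a = ∑ F with G.IsSplitForest a b F, treeWeight c hc F := by
  simp [forestPotential]

open Classical in
theorem forestPotential_right [Fintype V] (G : SimpleGraph V) (c : V → V → ℝ)
    (hc : ∀ i j, c i j = c j i) (a b : V) : forestPotential G c hc a b b = 0 := by
  refine Finset.sum_eq_zero fun F hF ↦ ?_
  simp [(Finset.mem_filter.mp hF).2.not_reachable]

open Classical in
theorem sum_treeWeight_mul_effRes [Fintype V] (G : SimpleGraph V) {c : V → V → ℝ}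
    (hc : ∀ i j, c i j = c j i) {Qd : Matrix V V ℝ} (hQd : IsMoorePenroseInv (lapMatrix G c) Qd)
    (hW : ∑ T with T ≤ G ∧ T.IsTree, treeWeight c hc T ≠ 0) (a b : V) :
    (∑ T with T ≤ G ∧ T.IsTree, treeWeight c hc T) * effRes Qd a b =
      ∑ F with G.IsSplitForest a b F, treeWeight c hc F := by
  have h := dotProduct_mulVec_of_isMoorePenroseInv (lapMatrix_transpose G hc) hQd
    (forestPotential G c hc a b)
  rw [lapMatrix_mulVec_forestPotential, mulVec_smul, dotProduct_smul, smul_dotProduct,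
    dotProduct_smul] at h
  simp only [smul_eq_mul] at h
  have h := mul_left_cancel₀ hW h
  rw [dotProduct_sub, dotProduct_single, dotProduct_single, mul_one, mul_one,
    forestPotential_left, forestPotential_right, sub_zero] at h
  exact h

open Classical in
/-- Kirchhoff's formula: `c a b * ω a b` is the probability that a random spanning tree contains the
link `a, b`. -/
theorem mul_effRes_eq_sum_div [Fintype V] (G : SimpleGraph V) {c : V → V → ℝ}
    (hc : ∀ i j, c i j = c j i) {Qd : Matrix V V ℝ} (hQd : IsMoorePenroseInv (lapMatrix G c) Qd)
    (hW : ∑ T with T ≤ G ∧ T.IsTree, treeWeight c hc T ≠ 0) {a b : V} (hab : G.Adj a b) :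
    c a b * effRes Qd a b =
      (∑ T with T ≤ G ∧ T.IsTree, if T.Adj a b then treeWeight c hc T else 0) /
        ∑ T with T ≤ G ∧ T.IsTree, treeWeight c hc T := by
  rw [eq_div_iff hW, mul_assoc, mul_comm (effRes Qd a b), sum_treeWeight_mul_effRes G hc hQd hW]
  simpa using mul_sum_isSplitForest G hc hab fun _ ↦ 1

/- STATEMENT 16: the node resistance curvature equals the expected combinatorial
curvature `1 - d_i^{(T)}/2` of the node in a random spanning tree `T`, sampled
with probability proportional to the product of its link weights. -/
theorem nodeCurv_eq_expected_combinatorial_curvature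
    [Fintype V] [DecidableEq V] (G : SimpleGraph V) [DecidableRel G.Adj]
    (c : V → V → ℝ) (hsymm : ∀ i j, c i j = c j i)
    (hpos : ∀ i j, G.Adj i j → 0 < c i j)
    (hconn : G.Connected)
    (Qd : Matrix V V ℝ) (hQd : IsMoorePenroseInv (lapMatrix G c) Qd)
    (i : V) :
    nodeCurv G c Qd i =
      ∑ᶠ T ∈ {T : SimpleGraph V | T ≤ G ∧ T.IsTree},
        treeWeight c hsymm T /
            (∑ᶠ T' ∈ {T' : SimpleGraph V | T' ≤ G ∧ T'.IsTree}, treeWeight c hsymm T') *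
          (1 - (({j | T.Adj i j} : Set V).ncard : ℝ) / 2) := by
  rename_i instDecEq instDecRel
  clear instDecEq instDecRel
  classical
  have hcoe : {T : SimpleGraph V | T ≤ G ∧ T.IsTree} =
      ↑({T | T ≤ G ∧ T.IsTree} : Finset (SimpleGraph V)) := by simp
  rw [hcoe, finsum_mem_coe_finset, finsum_mem_coe_finset]
  set W := ∑ T with T ≤ G ∧ T.IsTree, treeWeight c hsymm T with hWdef
  have hW : W ≠ 0 := by
    obtain ⟨T, hT, hT'⟩ := hconn.exists_isTree_le
    refine (Finset.sum_pos (fun T hT ↦ treeWeight_pos hsymm hpos (Finset.mem_filter.mp hT).2.1)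
      ⟨T, ?_⟩).ne'
    simpa using ⟨hT, hT'⟩
  have hlink (j : V) : (if G.Adj i j then c i j * effRes Qd i j else 0) =
      ∑ T with T ≤ G ∧ T.IsTree, treeWeight c hsymm T / W * if T.Adj i j then 1 else 0 := by
    split_ifs with hij
    · rw [mul_effRes_eq_sum_div G hsymm hQd hW hij, Finset.sum_div]
      refine Finset.sum_congr rfl fun T _ ↦ ?_
      split_ifs <;> simp [hWdef]
    · refine (Finset.sum_eq_zero fun T hT ↦ ?_).symm
      have hT' : ¬ T.Adj i j := fun h ↦ hij ((Finset.mem_filter.mp hT).2.1 h)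
      simp [hT']
  have hdeg (T : SimpleGraph V) :
      (∑ j, if T.Adj i j then (1 : ℝ) else 0) = ({j | T.Adj i j} : Set V).ncard := by
    rw [Finset.sum_boole, ← Set.ncard_coe_finset]
    simp
  have hprob : ∑ T with T ≤ G ∧ T.IsTree, treeWeight c hsymm T / W = 1 := by
    rw [← Finset.sum_div, div_self hW]
  rw [nodeCurv, Finset.sum_congr rfl fun j _ ↦ hlink j, Finset.sum_comm]
  simp_rw [← Finset.mul_sum, hdeg, mul_sub, mul_one, Finset.sum_sub_distrib, hprob,
    Finset.mul_sum]
  congr 1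
  refine Finset.sum_congr rfl fun T _ ↦ ?_
  ring
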